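/- There is a function f: ℕ×ℕ → ℕ such that for every M ∈ K, every finite subset A ⊆ M, and every m ∈ ℕ, the closure cl^m_M(A) is finite and |cl^m_M(A)| ≤ f(|A|, m). -/

import Mathlib

open FirstOrder Filter Topology
open scoped Classical

/-- The finite relational language with relation symbols `R i` of arity `k i`, for `i : Fin p`. -/
def Lang (p : ℕ) (k : Fin p → ℕ) : FirstOrder.Language where
  Functions := fun _ => Empty
  Relations := fun n => { i : Fin p // k i = n }

variable {p : ℕ}

section StructureDefs

/-- The relation `R i` holds on the finite set `C` (set-version of the relation). -/
def HoldsOn (k : Fin p → ℕ) {M : Type*} [(Lang p k).Structure M]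
    (i : Fin p) (C : Finset M) : Prop :=
  ∃ v : Fin (k i) → M, Function.Injective v ∧ Finset.image v Finset.univ = C ∧
    Language.Structure.RelMap (L := Lang p k) (⟨i, rfl⟩ : (Lang p k).Relations (k i)) v

/-- `w i A` : the number of `k i`-element subsets of `A` on which `R i` holds. -/
noncomputable def w (k : Fin p → ℕ) {M : Type*} [(Lang p k).Structure M]
    (i : Fin p) (A : Finset M) : ℕ :=
  Set.ncard {C : Finset M | C ⊆ A ∧ C.card = k i ∧ HoldsOn k i C}

/-- `e(A) = Σ_i α_i · w_i(A)`. -/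
noncomputable def eVal (k : Fin p → ℕ) (α : Fin p → ℝ) {M : Type*} [(Lang p k).Structure M]
    (A : Finset M) : ℝ :=
  ∑ i : Fin p, α i * (w k i A : ℝ)

/-- `δ(A) = |A| − e(A)`. -/
noncomputable def delta (k : Fin p → ℕ) (α : Fin p → ℝ) {M : Type*} [(Lang p k).Structure M]
    (A : Finset M) : ℝ :=
  (A.card : ℝ) - eVal k α A

/-- A structure is symmetric and irreflexive: relations hold only on tuples of pairwise
distinct elements and are invariant under permutations of the tuple. -/
def SymmIrr (k : Fin p → ℕ) (M : Type*) [(Lang p k).Structure M] : Prop :=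
  (∀ (n : ℕ) (r : (Lang p k).Relations n) (v : Fin n → M),
      Language.Structure.RelMap r v → Function.Injective v) ∧
  (∀ (n : ℕ) (r : (Lang p k).Relations n) (v : Fin n → M) (σ : Equiv.Perm (Fin n)),
      Language.Structure.RelMap r v → Language.Structure.RelMap r (v ∘ σ))

/-- Membership in the class `K`: a symmetric irreflexive structure all of whose finite
substructures have (hereditarily) nonnegative `δ`. -/
def InK (k : Fin p → ℕ) (α : Fin p → ℝ) (M : Type*) [(Lang p k).Structure M] : Prop :=
  SymmIrr k M ∧ ∀ A : Finset M, 0 ≤ delta k α A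

/-- A finite structure is in `K_α` if it is symmetric irreflexive and `δ(A) ≥ 0` for every
substructure. -/
def InKalpha (k : Fin p → ℕ) (α : Fin p → ℝ) (B : Type*) [(Lang p k).Structure B] : Prop :=
  SymmIrr k B ∧ ∀ S : Finset B, 0 ≤ delta k α S

/-- `d_B(X) = inf { δ(Y) : X ⊆ Y ⊆ B }` (relative version, inside the finite set `B`). -/
noncomputable def dRel (k : Fin p → ℕ) (α : Fin p → ℝ) {M : Type*} [(Lang p k).Structure M]
    (B X : Finset M) : ℝ :=
  sInf {r : ℝ | ∃ Y : Finset M, X ⊆ Y ∧ Y ⊆ B ∧ r = delta k α Y}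

/-- `A ≤_s B` for finite sets: `A ⊆ B` and `d_A(X) = d_B(X)` for all `X ⊆ A`. -/
def StrongIn (k : Fin p → ℕ) (α : Fin p → ℝ) {M : Type*} [(Lang p k).Structure M]
    (A B : Finset M) : Prop :=
  A ⊆ B ∧ ∀ X : Finset M, X ⊆ A → dRel k α A X = dRel k α B X

/-- `A ≤_i B` (intrinsic extension): there is no `A'` with `A ⊆ A' ⊊ B` and `A' ≤_s B`. -/
def IntrinsicIn (k : Fin p → ℕ) (α : Fin p → ℝ) {M : Type*} [(Lang p k).Structure M]
    (A B : Finset M) : Prop :=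
  A ⊆ B ∧ ∀ A' : Finset M, A ⊆ A' → A' ⊂ B → ¬ StrongIn k α A' B

/-- `cl^m_M(A)`: the union of all `B ⊆ M` with `A ≤_i B` and `|B − A| < m`. -/
def cl (k : Fin p → ℕ) (α : Fin p → ℝ) {M : Type*} [(Lang p k).Structure M]
    (m : ℕ) (A : Finset M) : Set M :=
  {x : M | ∃ B : Finset M, IntrinsicIn k α A B ∧ (B \ A).card < m ∧ x ∈ B}

/-- `C` and `B'` are freely joined over `A` (inside the ambient structure): they intersect in
`A` and every relation on a subset of `C ∪ B'` lives entirely inside `C` or inside `B'`. -/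
def FreelyJoined (k : Fin p → ℕ) {M : Type*} [(Lang p k).Structure M]
    (A C B' : Set M) : Prop :=
  C ∩ B' = A ∧
    ∀ (i : Fin p) (S : Finset M), ↑S ⊆ C ∪ B' → HoldsOn k i S → (↑S ⊆ C ∨ ↑S ⊆ B')

/-- `g` is an embedding (of relational structures). -/
def IsEmb (k : Fin p → ℕ) {M N : Type*} [(Lang p k).Structure M] [(Lang p k).Structure N]
    (g : M → N) : Prop :=
  Function.Injective g ∧
    ∀ (n : ℕ) (r : (Lang p k).Relations n) (v : Fin n → M),
      (Language.Structure.RelMap r (g ∘ v) ↔ Language.Structure.RelMap r v)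

/-- `g` restricted to `A` is an embedding of the substructure on `A`. -/
def IsEmbOn (k : Fin p → ℕ) {M N : Type*} [(Lang p k).Structure M] [(Lang p k).Structure N]
    (A : Finset M) (g : M → N) : Prop :=
  Set.InjOn g ↑A ∧
    ∀ (n : ℕ) (r : (Lang p k).Relations n) (v : Fin n → M), (∀ j, v j ∈ A) →
      (Language.Structure.RelMap r (g ∘ v) ↔ Language.Structure.RelMap r v)

/-- `h` restricts to an isomorphism from the induced structure on `S` onto `S'`. -/
def IsIsoOn (k : Fin p → ℕ) {M N : Type*} [(Lang p k).Structure M] [(Lang p k).Structure N]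
    (S : Set M) (S' : Set N) (h : M → N) : Prop :=
  Set.InjOn h S ∧ h '' S = S' ∧
    ∀ (n : ℕ) (r : (Lang p k).Relations n) (v : Fin n → M), (∀ j, v j ∈ S) →
      (Language.Structure.RelMap r (h ∘ v) ↔ Language.Structure.RelMap r v)

/-- A countable structure `M ∈ K` is `(K_α, ≤_s)`-semigeneric if for every `A ≤_s B` with
`B ∈ K_α` finite and every embedding `g` of `A` into `M`, and each `m`, there is an embedding
`ĝ` of `B` into `M` extending `g` whose image adds nothing to the `m`-closure of `gA` and is
freely joined with `cl^m(gA)` over `gA`. -/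
def Semigeneric (k : Fin p → ℕ) (α : Fin p → ℝ) (M : Type*) [(Lang p k).Structure M] : Prop :=
  Countable M ∧ InK k α M ∧
    ∀ (B : Type) (_ : Fintype B) (_ : (Lang p k).Structure B), InKalpha k α B →
      ∀ A : Finset B, StrongIn k α A Finset.univ →
        ∀ g : B → M, IsEmbOn k A g → ∀ m : ℕ,
          ∃ g' : B → M, IsEmb k g' ∧ (∀ a ∈ A, g' a = g a) ∧
            cl k α m (Finset.image g' Finset.univ) =
              ↑(Finset.image g' Finset.univ) ∪ cl k α m (Finset.image g A) ∧
            FreelyJoined k (↑(Finset.image g A) : Set M) (cl k α m (Finset.image g A))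
              (↑(Finset.image g' Finset.univ))

end StructureDefs

section FormulaDefs

/-- A formula is existential if it is an existential quantifier prefix applied to a
quantifier-free formula. -/
def IsExistential (k : Fin p → ℕ) {r : ℕ} (φ : (Lang p k).Formula (Fin r)) : Prop :=
  ∃ (m : ℕ) (ψ : (Lang p k).BoundedFormula (Fin r) m), ψ.IsQF ∧ φ = ψ.exs

/-- Boolean combinations of existential formulas. -/
inductive IsBoolCombExistential (k : Fin p → ℕ) {r : ℕ} :
    (Lang p k).Formula (Fin r) → Prop
  | of_existential (φ) : IsExistential k φ → IsBoolCombExistential k φ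
  | not (φ) : IsBoolCombExistential k φ → IsBoolCombExistential k φ.not
  | inf (φ ψ) : IsBoolCombExistential k φ → IsBoolCombExistential k ψ →
      IsBoolCombExistential k (φ ⊓ ψ)

end FormulaDefs

section Probability

/-- A configuration of potential relations on `{1,…,n}`: for each relation symbol, a Boolean
choice on each finite subset. -/
abbrev Config (p n : ℕ) := (i : Fin p) → Finset (Fin n) → Bool

/-- The valid configurations: `R i` may only hold on sets of size `k i`. -/
noncomputable def validE (k : Fin p → ℕ) (n : ℕ) : Finset (Config p n) :=
  Finset.univ.filter (fun E => ∀ (i : Fin p) (C : Finset (Fin n)), E i C = true → C.card = k i)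

/-- The probability of the configuration `E`: independently for each `i` and each
`k i`-element set `C`, the relation `R i` holds on `C` with probability `γ i · n^{-α i}`. -/
noncomputable def weight (k : Fin p → ℕ) (α γ : Fin p → ℝ) (n : ℕ) (E : Config p n) : ℝ :=
  ∏ i : Fin p, ∏ C ∈ Finset.univ.filter (fun C : Finset (Fin n) => C.card = k i),
    (if E i C = true then γ i * (n : ℝ) ^ (-(α i)) else 1 - γ i * (n : ℝ) ^ (-(α i)))

/-- The probability `P_n` of an event (a set of configurations). -/
noncomputable def Pev (k : Fin p → ℕ) (α γ : Fin p → ℝ) (n : ℕ)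
    (Q : Config p n → Prop) : ℝ :=
  ∑ E ∈ validE k n, if Q E then weight k α γ n E else 0

/-- The random `L⁺`-structure `G_n` on `Fin n` determined by the configuration `E`. -/
def structOf (k : Fin p → ℕ) (n : ℕ) (E : Config p n) : (Lang p k).Structure (Fin n) where
  funMap := fun {_} f _ => f.elim
  RelMap := fun {_} r v => Function.Injective v ∧ E r.1 (Finset.image v Finset.univ) = true

/-- The probability that `G_n ⊨ φ`. -/
noncomputable def Pn (k : Fin p → ℕ) (α γ : Fin p → ℝ) (n : ℕ)
    (φ : (Lang p k).Sentence) : ℝ :=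
  Pev k α γ n (fun E => letI := structOf k n E; (Fin n) ⊨ φ)

/-- The Irrationality Hypothesis: `α_0, …, α_{p−1}, 1` are linearly independent over `ℚ`. -/
def IrrHyp (α : Fin p → ℝ) : Prop :=
  LinearIndependent ℚ (Fin.snoc α (1 : ℝ) : Fin (p + 1) → ℝ)

/-- The almost sure theory `T^α`: the sentences with limit probability 1. -/
noncomputable def Talpha (k : Fin p → ℕ) (α γ : Fin p → ℝ) : (Lang p k).Theory :=
  {φ : (Lang p k).Sentence | Tendsto (fun n => Pn k α γ n φ) atTop (𝓝 1)}

/-- Auxiliary: `M`, equipped with the structure `S`, satisfies the sentence `φ`. -/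
def RealizeS (k : Fin p → ℕ) (M : Type*) (S : (Lang p k).Structure M)
    (φ : (Lang p k).Sentence) : Prop :=
  letI := S; M ⊨ φ

/-- Auxiliary: `M`, equipped with the structure `S`, is a model of the theory `T`. -/
def ModelsT (k : Fin p → ℕ) (M : Type*) (S : (Lang p k).Structure M)
    (T : (Lang p k).Theory) : Prop :=
  ∀ φ ∈ T, RealizeS k M S φ

end Probability


section IntrinsicClosure

variable {k : Fin p → ℕ} {α : Fin p → ℝ} {M : Type*} [(Lang p k).Structure M]

theorem finite_w_set (i : Fin p) (A : Finset M) :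
    {C : Finset M | C ⊆ A ∧ C.card = k i ∧ HoldsOn k i C}.Finite :=
  A.powerset.finite_toSet.subset fun _ hC => Finset.mem_coe.2 (Finset.mem_powerset.2 hC.1)

theorem w_mono (i : Fin p) {A B : Finset M} (h : A ⊆ B) : w k i A ≤ w k i B :=
  Set.ncard_le_ncard (fun _ hC => ⟨hC.1.trans h, hC.2⟩) (finite_w_set i B)

/-- The relation counts are supermodular. -/
theorem w_add_w_le (i : Fin p) (A B : Finset M) :
    w k i A + w k i B ≤ w k i (A ∪ B) + w k i (A ∩ B) := by
  have h := Set.ncard_union_add_ncard_inter _ _ (finite_w_set (k := k) i A)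
    (finite_w_set (k := k) i B)
  unfold w
  rw [← h]
  refine Nat.add_le_add (Set.ncard_le_ncard ?_ (finite_w_set i _))
    (Set.ncard_le_ncard ?_ (finite_w_set i _))
  · rintro C (hC | hC)
    · exact ⟨hC.1.trans Finset.subset_union_left, hC.2⟩
    · exact ⟨hC.1.trans Finset.subset_union_right, hC.2⟩
  · rintro C ⟨hA, hB⟩
    exact ⟨Finset.subset_inter hA.1 hB.1, hA.2⟩

/-- The predimension `δ` is submodular. -/
theorem delta_union_add_delta_inter_le (hα : ∀ i, 0 < α i) (A B : Finset M) :
    delta k α (A ∪ B) + delta k α (A ∩ B) ≤ delta k α A + delta k α B := by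
  have hcard : ((A ∪ B).card : ℝ) + ((A ∩ B).card : ℝ) = A.card + B.card := by
    exact_mod_cast Finset.card_union_add_card_inter A B
  have he : eVal k α A + eVal k α B ≤ eVal k α (A ∪ B) + eVal k α (A ∩ B) := by
    simp only [eVal, ← Finset.sum_add_distrib, ← mul_add]
    refine Finset.sum_le_sum fun i _ => mul_le_mul_of_nonneg_left ?_ (hα i).le
    exact_mod_cast w_add_w_le i A B
  unfold delta
  linarith

theorem delta_le_card (hα : ∀ i, 0 < α i) (A : Finset M) : delta k α A ≤ A.card := by
  have : 0 ≤ eVal k α A :=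
    Finset.sum_nonneg fun i _ => mul_nonneg (hα i).le (Nat.cast_nonneg _)
  unfold delta
  linarith

theorem delta_sub_delta {A B : Finset M} (h : A ⊆ B) :
    delta k α B - delta k α A =
      ((B \ A).card : ℝ) - ∑ i, α i * ((w k i B - w k i A : ℕ) : ℝ) := by
  have hw : ∀ i, α i * ((w k i B - w k i A : ℕ) : ℝ) = α i * w k i B - α i * w k i A := by
    intro i
    rw [Nat.cast_sub (w_mono i h), mul_sub]
  have hcard : ((B \ A).card : ℝ) + A.card = B.card := by
    exact_mod_cast Finset.card_sdiff_add_card_eq_card h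
  simp only [hw, Finset.sum_sub_distrib, delta, eVal]
  linarith

theorem strongIn_of_delta_inter_le (hM : InK k α M) {A B : Finset M} (hAB : A ⊆ B)
    (h : ∀ Y ⊆ B, delta k α (Y ∩ A) ≤ delta k α Y) : StrongIn k α A B := by
  have hbdd : ∀ B X : Finset M,
      BddBelow {r : ℝ | ∃ Y : Finset M, X ⊆ Y ∧ Y ⊆ B ∧ r = delta k α Y} := by
    rintro B X
    refine ⟨0, ?_⟩
    rintro _ ⟨Y, -, -, rfl⟩
    exact hM.2 Y
  refine ⟨hAB, fun X hX => le_antisymm ?_ ?_⟩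
  · refine le_csInf ⟨_, X, subset_rfl, hX.trans hAB, rfl⟩ ?_
    rintro _ ⟨Y, hXY, hYB, rfl⟩
    exact csInf_le_of_le (hbdd _ _)
      ⟨Y ∩ A, Finset.subset_inter hXY hX, Finset.inter_subset_right, rfl⟩ (h Y hYB)
  · refine csInf_le_csInf (hbdd _ _) ⟨_, X, subset_rfl, hX, rfl⟩ ?_
    rintro _ ⟨Y, hXY, hYA, rfl⟩
    exact ⟨Y, hXY, hYA.trans hAB, rfl⟩

theorem IntrinsicIn.exists_delta_lt (hα : ∀ i, 0 < α i) (hM : InK k α M) {A B A' : Finset M}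
    (hAB : IntrinsicIn k α A B) (hA : A ⊆ A') (hB : A' ⊂ B) :
    ∃ B', A' ⊆ B' ∧ B' ⊆ B ∧ delta k α B' < delta k α A' := by
  by_contra! hcon
  refine hAB.2 A' hA hB (strongIn_of_delta_inter_le hM hB.1 fun Y hY => ?_)
  have h1 := hcon (Y ∪ A') Finset.subset_union_right (Finset.union_subset hY hB.1)
  have h2 := delta_union_add_delta_inter_le (k := k) hα Y A'
  linarith

end IntrinsicClosure

/-- The values of a positive linear form on `ℕ`-vectors do not accumulate from above. -/
theorem exists_gap_sum_mul_natCast {ι : Type*} [Fintype ι] {α : ι → ℝ} (hα : ∀ i, 0 < α i)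
    (c : ℝ) :
    ∃ ε > 0, ∀ n : ι → ℕ, c < ∑ i, α i * (n i : ℝ) → c + ε ≤ ∑ i, α i * (n i : ℝ) := by
  let T : Set (ι → ℕ) := {n | c < ∑ i, α i * (n i : ℝ) ∧ ∑ i, α i * (n i : ℝ) ≤ c + 1}
  have hT : T.Finite := by
    refine (Set.finite_Iic (fun i => ⌊(c + 1) / α i⌋₊)).subset fun n hn i => ?_
    refine Nat.le_floor ((le_div_iff₀ (hα i)).2 ?_)
    have := Finset.single_le_sum (f := fun i => α i * (n i : ℝ))
      (fun j _ => mul_nonneg (hα j).le (Nat.cast_nonneg _)) (Finset.mem_univ i)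
    have h2 := hn.2
    linarith
  rcases T.eq_empty_or_nonempty with hE | hne
  · refine ⟨1, one_pos, fun n hn => ?_⟩
    by_contra! hlt
    exact hE.subset (show n ∈ T from ⟨hn, hlt.le⟩)
  · obtain ⟨n₀, hn₀, hmin⟩ := hT.exists_minimalFor (fun n => ∑ i, α i * (n i : ℝ)) T hne
    refine ⟨(∑ i, α i * (n₀ i : ℝ)) - c, sub_pos.2 hn₀.1, fun n hn => ?_⟩
    rw [add_sub_cancel]
    by_contra! hlt
    exact absurd (hmin (j := n) ⟨hn, hlt.le.trans hn₀.2⟩ hlt.le) (not_le.2 hlt)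

theorem exists_uniform_gap_sum_mul_natCast {ι : Type*} [Fintype ι] {α : ι → ℝ}
    (hα : ∀ i, 0 < α i) (m : ℕ) :
    ∃ ε > 0, ∀ j < m, ∀ n : ι → ℕ,
      (j : ℝ) < ∑ i, α i * (n i : ℝ) → (j : ℝ) + ε ≤ ∑ i, α i * (n i : ℝ) := by
  induction m with
  | zero => exact ⟨1, one_pos, fun j hj => absurd hj (Nat.not_lt_zero j)⟩
  | succ m ih =>
    obtain ⟨ε₁, h₁, H₁⟩ := ih
    obtain ⟨ε₂, h₂, H₂⟩ := exists_gap_sum_mul_natCast hα (m : ℝ)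
    refine ⟨min ε₁ ε₂, lt_min h₁ h₂, fun j hj n hn => ?_⟩
    rcases Nat.lt_succ_iff_lt_or_eq.1 hj with hj | rfl
    · linarith [H₁ j hj n hn, min_le_left ε₁ ε₂]
    · linarith [H₂ n hn, min_le_right ε₁ ε₂]

theorem exists_finset_cl_subset {k : Fin p → ℕ} {α : Fin p → ℝ} {M : Type*}
    [(Lang p k).Structure M] (hα : ∀ i, 0 < α i) (hM : InK k α M) {m : ℕ} {ε : ℝ}
    (hgap : ∀ j < m, ∀ n : Fin p → ℕ,
      (j : ℝ) < ∑ i, α i * (n i : ℝ) → (j : ℝ) + ε ≤ ∑ i, α i * (n i : ℝ))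
    (A : Finset M) (N : ℕ) (C : Finset M) (hAC : A ⊆ C) (hC : delta k α C < N * ε) :
    ∃ D : Finset M, cl k α m A ⊆ D ∧ D.card ≤ C.card + N * m := by
  induction N generalizing C with
  | zero =>
    have := hM.2 C
    simp only [Nat.cast_zero, zero_mul] at hC
    linarith
  | succ N ih =>
    by_cases hcl : cl k α m A ⊆ C
    · exact ⟨C, hcl, Nat.le_add_right _ _⟩
    obtain ⟨x, ⟨B, hAB, hcard, hxB⟩, hxC⟩ := Set.not_subset.1 hcl
    have hss : B ∩ C ⊂ B := Finset.ssubset_iff_subset_ne.2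
      ⟨Finset.inter_subset_left, fun h => hxC (Finset.inter_eq_left.1 h hxB)⟩
    have hA : A ⊆ B ∩ C := Finset.subset_inter hAB.1 hAC
    obtain ⟨B', h1, h2, h3⟩ := hAB.exists_delta_lt hα hM hA hss
    have hlt : (B' \ (B ∩ C)).card < m :=
      (Finset.card_le_card (Finset.sdiff_subset_sdiff h2 hA)).trans_lt hcard
    have hdrop : delta k α B' + ε ≤ delta k α (B ∩ C) := by
      have h4 := delta_sub_delta (k := k) (α := α) h1
      have h5 := hgap _ hlt (fun i => w k i B' - w k i (B ∩ C)) (by linarith)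
      linarith
    have hinter : B' ∩ C = B ∩ C := subset_antisymm
      (Finset.inter_subset_inter_right h2)
      (Finset.subset_inter h1 Finset.inter_subset_right)
    have hsub := delta_union_add_delta_inter_le (k := k) hα B' C
    rw [hinter] at hsub
    obtain ⟨D, hD, hDcard⟩ := ih (B' ∪ C) (hAC.trans Finset.subset_union_right) (by
      push_cast at hC
      linarith)
    refine ⟨D, hD, hDcard.trans ?_⟩
    have hunion : (B' ∪ C).card ≤ C.card + m := by
      have h6 : B' ∪ C ⊆ C ∪ (B' \ (B ∩ C)) := by
        intro y hy
        simp only [Finset.mem_union, Finset.mem_sdiff, Finset.mem_inter] at hy ⊢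
        tauto
      exact (Finset.card_le_card h6).trans ((Finset.card_union_le _ _).trans
        (Nat.add_le_add_left hlt.le _))
    rw [Nat.succ_mul]
    omega

-- STATEMENT 14
theorem cl_finite_uniformly_bounded (k : Fin p → ℕ) (α : Fin p → ℝ)
    (hα : ∀ i, 0 < α i ∧ α i ≤ 1) :
    ∃ f : ℕ → ℕ → ℕ, ∀ (M : Type*) [(Lang p k).Structure M], InK k α M →
      ∀ (A : Finset M) (m : ℕ),
        (cl k α m A).Finite ∧ (cl k α m A).ncard ≤ f A.card m := by
  have hpos : ∀ i, 0 < α i := fun i => (hα i).1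
  choose ε hε hgap using fun m => exists_uniform_gap_sum_mul_natCast hpos m
  refine ⟨fun a m => a + (⌊a / ε m⌋₊ + 1) * m, fun M _ hM A m => ?_⟩
  obtain ⟨D, hD, hcard⟩ := exists_finset_cl_subset hpos hM (hgap m) A
    (⌊A.card / ε m⌋₊ + 1) A subset_rfl (by
      refine (delta_le_card hpos A).trans_lt ((div_lt_iff₀ (hε m)).1 ?_)
      exact_mod_cast Nat.lt_floor_add_one ((A.card : ℝ) / ε m))
  refine ⟨D.finite_toSet.subset hD, ?_⟩
  exact (Set.ncard_le_ncard hD D.finite_toSet).trans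
    ((Set.ncard_coe_finset D).le.trans hcard)
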